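/- arXiv:2605.02756 — 6 statements merged into one kernel-verified Lean document; each statement's English description precedes it below -/
import Mathlib

section
/- Let K ≥ 1, let p : Fin K → Fin K → ℝ be entrywise nonnegative with each row summing to 1, let q : Fin K → ℝ satisfy 0 < q j < 1 for all j, let λ : Fin K → ℝ satisfy 0 ≤ λ k ≤ 1 for all k, and let α, α̂ : Fin K → ℝ. Then there exists a unique vector x : Fin K → ℝ such that for every k, x k = (1 − λ k) * α̂ k + λ k * (∑ j, p k j * (q j * α j + (1 − q j) * x j)). -/
/-- A linear fixed-point system whose coefficient matrix has absolute row sums below one has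
only the trivial homogeneous solution. -/
theorem eq_zero_of_eq_mulVec_of_sum_abs_lt_one {ι : Type*} [Fintype ι] (A : Matrix ι ι ℝ)
    (hA : ∀ k, ∑ j, |A k j| < 1) {x : ι → ℝ} (hx : x = A.mulVec x) : x = 0 := by
  cases isEmpty_or_nonempty ι
  · exact Subsingleton.elim _ _
  obtain ⟨m, hm⟩ := Finite.exists_max fun k => |x k|
  have hle : |x m| ≤ (∑ j, |A m j|) * |x m| := by
    calc |x m| = |∑ j, A m j * x j| := congrArg abs (congrFun hx m)
      _ ≤ ∑ j, |A m j * x j| := Finset.abs_sum_le_sum_abs _ _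
      _ ≤ ∑ j, |A m j| * |x m| := Finset.sum_le_sum fun j _ => by
          rw [abs_mul]
          exact mul_le_mul_of_nonneg_left (hm j) (abs_nonneg _)
      _ = (∑ j, |A m j|) * |x m| := by rw [Finset.sum_mul]
  have hzero : |x m| ≤ 0 := by nlinarith [hA m, abs_nonneg (x m)]
  ext k
  exact abs_nonpos_iff.mp ((hm k).trans hzero)

/-- A linear fixed-point system whose coefficient matrix has absolute row sums below one has
exactly one solution. -/
theorem existsUnique_eq_add_mulVec_of_sum_abs_lt_one {ι : Type*} [Fintype ι]
    (A : Matrix ι ι ℝ) (hA : ∀ k, ∑ j, |A k j| < 1) (b : ι → ℝ) :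
    ∃! x : ι → ℝ, x = b + A.mulVec x := by
  let L : (ι → ℝ) →ₗ[ℝ] (ι → ℝ) := LinearMap.id - A.mulVecLin
  have hinj : Function.Injective L := by
    refine (injective_iff_map_eq_zero L).mpr fun x hx => ?_
    exact eq_zero_of_eq_mulVec_of_sum_abs_lt_one A hA (sub_eq_zero.mp hx)
  have hbij : Function.Bijective L := ⟨hinj, LinearMap.injective_iff_surjective.mp hinj⟩
  obtain ⟨x, hx, huniq⟩ := hbij.existsUnique b
  exact ⟨x, sub_eq_iff_eq_add.mp hx, fun y hy => huniq y (sub_eq_iff_eq_add.mpr hy)⟩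

/-- Weights of total mass one, damped by factors below one, have total mass below one. -/
theorem sum_mul_one_sub_lt_one {ι : Type*} [Fintype ι] {w q : ι → ℝ}
    (hw : ∀ j, 0 ≤ w j) (hsum : ∑ j, w j = 1) (hq : ∀ j, 0 < q j) :
    ∑ j, w j * (1 - q j) < 1 := by
  obtain ⟨i, -, hi⟩ : ∃ i ∈ Finset.univ, w i ≠ 0 :=
    Finset.exists_ne_zero_of_sum_ne_zero (by rw [hsum]; exact one_ne_zero)
  have hipos : 0 < w i := (hw i).lt_of_ne' hi
  calc ∑ j, w j * (1 - q j) < ∑ j, w j :=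
        Finset.sum_lt_sum (fun j _ => by nlinarith [hw j, hq j])
          ⟨i, Finset.mem_univ i, by nlinarith [hq i]⟩
    _ = 1 := hsum


/-- The system of subjective best responses has a unique solution. -/
theorem stmt_0 (K : ℕ) (hK : 1 ≤ K)
    (p : Fin K → Fin K → ℝ)
    (hp : ∀ k j, 0 ≤ p k j)
    (hrow : ∀ k, ∑ j, p k j = 1)
    (q : Fin K → ℝ) (hq : ∀ j, 0 < q j ∧ q j < 1)
    (lam : Fin K → ℝ) (hlam : ∀ k, 0 ≤ lam k ∧ lam k ≤ 1)
    (α αhat : Fin K → ℝ) :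
    ∃! x : Fin K → ℝ, ∀ k,
      x k = (1 - lam k) * αhat k
        + lam k * (∑ j, p k j * (q j * α j + (1 - q j) * x j)) := by
  let A : Matrix (Fin K) (Fin K) ℝ := fun k j => lam k * (p k j * (1 - q j))
  let b : Fin K → ℝ := fun k =>
    (1 - lam k) * αhat k + lam k * ∑ j, p k j * (q j * α j)
  have hnonneg : ∀ k j, 0 ≤ p k j * (1 - q j) := fun k j =>
    mul_nonneg (hp k j) (sub_nonneg.mpr (hq j).2.le)
  have hA : ∀ k, ∑ j, |A k j| < 1 := fun k =>
    calc ∑ j, |A k j| ≤ ∑ j, p k j * (1 - q j) := Finset.sum_le_sum fun j _ => by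
          rw [abs_of_nonneg (mul_nonneg (hlam k).1 (hnonneg k j))]
          exact mul_le_of_le_one_left (hnonneg k j) (hlam k).2
      _ < 1 := sum_mul_one_sub_lt_one (hp k) (hrow k) fun j => (hq j).1
  have hrhs : ∀ (x : Fin K → ℝ) (k : Fin K), (b + A.mulVec x) k =
      (1 - lam k) * αhat k + lam k * (∑ j, p k j * (q j * α j + (1 - q j) * x j)) := by
    intro x k
    simp only [Pi.add_apply, Matrix.mulVec, dotProduct, A, b, mul_add, Finset.sum_add_distrib,
      Finset.mul_sum, mul_assoc, add_assoc]
  simpa only [funext_iff, hrhs] using existsUnique_eq_add_mulVec_of_sum_abs_lt_one A hA b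
end

section
/- Let K ≥ 1, let p : Fin K → Fin K → ℝ be entrywise nonnegative with each row summing to 1, let q : Fin K → ℝ satisfy 0 < q j < 1 for all j, and let λ : Fin K → ℝ satisfy 0 ≤ λ k ≤ 1 for all k. Define the K × K matrix A by A k k = 1 − p k k * λ k * (1 − q k) on the diagonal and A k j = − λ k * p k j * (1 − q j) off the diagonal (j ≠ k). Then A is strictly diagonally dominant, i.e., for every k, |A k k| > ∑ j ≠ k, |A k j|, and consequently A is invertible. -/
/-- The coefficient matrix of the best-response system is strictly diagonally
dominant, hence invertible. -/
theorem stmt_1 (K : ℕ) (hK : 1 ≤ K)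
    (p : Fin K → Fin K → ℝ)
    (hp : ∀ k j, 0 ≤ p k j)
    (hrow : ∀ k, ∑ j, p k j = 1)
    (q : Fin K → ℝ) (hq : ∀ j, 0 < q j ∧ q j < 1)
    (lam : Fin K → ℝ) (hlam : ∀ k, 0 ≤ lam k ∧ lam k ≤ 1)
    (A : Matrix (Fin K) (Fin K) ℝ)
    (hA : ∀ k j, A k j =
      if j = k then 1 - p k k * lam k * (1 - q k)
      else -(lam k * p k j * (1 - q j))) :
    (∀ k, ∑ j ∈ Finset.univ.erase k, |A k j| < |A k k|) ∧ IsUnit A := by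
  have hsum : ∀ k, ∑ j, lam k * p k j * (1 - q j) < 1 := by
    intro k
    have hweight : ∀ j, lam k * (1 - q j) < 1 := fun j => by
      nlinarith [hlam k, hq j]
    refine (Finset.sum_lt_sum (fun j _ => ?_) ?_).trans_eq (hrow k)
    · nlinarith [mul_nonneg (hp k j) (sub_nonneg.2 (hweight j).le)]
    · obtain ⟨j, hj, hne⟩ := Finset.exists_ne_zero_of_sum_ne_zero
        (show ∑ j, p k j ≠ 0 by rw [hrow k]; exact one_ne_zero)
      refine ⟨j, hj, ?_⟩
      nlinarith [mul_pos ((hp k j).lt_of_ne' hne) (sub_pos.2 (hweight j))]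
  have hdom : ∀ k, ∑ j ∈ Finset.univ.erase k, |A k j| < |A k k| := by
    intro k
    have hoff : ∑ j ∈ Finset.univ.erase k, |A k j| =
        ∑ j ∈ Finset.univ.erase k, lam k * p k j * (1 - q j) := by
      refine Finset.sum_congr rfl fun j hj => ?_
      rw [hA, if_neg (Finset.ne_of_mem_erase hj), abs_neg, abs_of_nonneg]
      exact mul_nonneg (mul_nonneg (hlam k).1 (hp k j)) (sub_nonneg.2 (hq j).2.le)
    have hsplit := Finset.add_sum_erase Finset.univ
      (fun j => lam k * p k j * (1 - q j)) (Finset.mem_univ k)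
    have hdiag : A k k = 1 - p k k * lam k * (1 - q k) := by rw [hA, if_pos rfl]
    rw [hoff, hdiag]
    refine lt_of_lt_of_le ?_ (le_abs_self _)
    linarith [hsum k]
  refine ⟨hdom, ?_⟩
  rw [Matrix.isUnit_iff_isUnit_det, isUnit_iff_ne_zero]
  exact det_ne_zero_of_sum_row_lt_diag hdom
end

section
/- Let K ≥ 1, let p : Fin K → Fin K → ℝ be entrywise nonnegative with each row summing to 1, let q : Fin K → ℝ satisfy 0 < q j < 1 for all j, and let λ : Fin K → ℝ satisfy 0 ≤ λ k ≤ 1 for all k. Define the K × K matrix A by A k k = 1 − p k k * λ k * (1 − q k) and A k j = − λ k * p k j * (1 − q j) for j ≠ k. Then A is invertible and every entry of A⁻¹ is nonnegative. -/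
/-- Minimum principle: if `A` has nonpositive off-diagonal entries and positive row sums,
then `0 ≤ A *ᵥ x` forces `0 ≤ x`. -/
theorem Matrix.nonneg_of_mulVec_nonneg {n : Type*} [Fintype n] {A : Matrix n n ℝ}
    (hoff : ∀ i j, j ≠ i → A i j ≤ 0) (hsum : ∀ i, 0 < ∑ j, A i j)
    {x : n → ℝ} (hx : 0 ≤ A.mulVec x) : 0 ≤ x := by
  intro k
  by_contra! hk
  have : Nonempty n := ⟨k⟩
  obtain ⟨i, hi⟩ := Finite.exists_min x
  have hneg : x i < 0 := (hi k).trans_lt hk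
  have hle : A.mulVec x i ≤ (∑ j, A i j) * x i := by
    rw [Finset.sum_mul]
    refine Finset.sum_le_sum fun j _ => ?_
    rcases eq_or_ne j i with rfl | hj
    · rfl
    · exact mul_le_mul_of_nonpos_left (hi j) (hoff i j hj)
  exact absurd (hx i) (hle.trans_lt (mul_neg_of_pos_of_neg (hsum i) hneg)).not_ge

/-- A matrix with nonpositive off-diagonal entries and positive row sums is invertible. -/
theorem Matrix.isUnit_of_offDiag_nonpos_of_sum_row_pos {n : Type*} [Fintype n] [DecidableEq n]
    {A : Matrix n n ℝ} (hoff : ∀ i j, j ≠ i → A i j ≤ 0) (hsum : ∀ i, 0 < ∑ j, A i j) :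
    IsUnit A := by
  rw [← Matrix.mulVec_injective_iff_isUnit]
  intro x y hxy
  have hxy : A.mulVec x = A.mulVec y := hxy
  apply le_antisymm
  · exact sub_nonneg.mp (nonneg_of_mulVec_nonneg hoff hsum (by rw [mulVec_sub, hxy, sub_self]))
  · exact sub_nonneg.mp (nonneg_of_mulVec_nonneg hoff hsum (by rw [mulVec_sub, hxy, sub_self]))

/-- A matrix with nonpositive off-diagonal entries and positive row sums has an entrywise
nonnegative inverse. -/
theorem Matrix.inv_nonneg_of_offDiag_nonpos_of_sum_row_pos {n : Type*} [Fintype n]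
    [DecidableEq n] {A : Matrix n n ℝ} (hoff : ∀ i j, j ≠ i → A i j ≤ 0)
    (hsum : ∀ i, 0 < ∑ j, A i j) (i j : n) : 0 ≤ A⁻¹ i j := by
  have hdet : IsUnit A.det :=
    A.isUnit_iff_isUnit_det.mp (isUnit_of_offDiag_nonpos_of_sum_row_pos hoff hsum)
  refine nonneg_of_mulVec_nonneg hoff hsum (x := fun k => A⁻¹ k j) (fun k => ?_) i
  change 0 ≤ (A * A⁻¹) k j
  rw [A.mul_nonsing_inv hdet, one_apply]
  split_ifs <;> norm_num

/-- The coefficient matrix of the best-response system is invertible and its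
inverse has nonnegative entries (it is a nonsingular M-matrix). -/
theorem stmt_2 (K : ℕ) (hK : 1 ≤ K)
    (p : Fin K → Fin K → ℝ)
    (hp : ∀ k j, 0 ≤ p k j)
    (hrow : ∀ k, ∑ j, p k j = 1)
    (q : Fin K → ℝ) (hq : ∀ j, 0 < q j ∧ q j < 1)
    (lam : Fin K → ℝ) (hlam : ∀ k, 0 ≤ lam k ∧ lam k ≤ 1)
    (A : Matrix (Fin K) (Fin K) ℝ)
    (hA : ∀ k j, A k j =
      if j = k then 1 - p k k * lam k * (1 - q k)
      else -(lam k * p k j * (1 - q j))) :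
    IsUnit A ∧ ∀ k j, 0 ≤ A⁻¹ k j := by
  have hoff : ∀ k j, j ≠ k → A k j ≤ 0 := fun k j hj => by
    rw [hA, if_neg hj, neg_nonpos]
    exact mul_nonneg (mul_nonneg (hlam k).1 (hp k j)) (sub_nonneg.mpr (hq j).2.le)
  have hsum : ∀ k, 0 < ∑ j, A k j := fun k => by
    have hA' : ∀ j, A k j = (if j = k then 1 else 0) - lam k * p k j * (1 - q j) := fun j => by
      rw [hA]
      split_ifs with h
      · subst h; ring
      · ring
    have hrw : ∑ j, A k j = ∑ j, p k j * (1 - lam k * (1 - q j)) := by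
      have hterm : ∀ j, p k j * (1 - lam k * (1 - q j)) =
          p k j - lam k * p k j * (1 - q j) := fun j => by ring
      simp [hA', hterm, Finset.sum_sub_distrib, hrow]
    have hw : ∀ j, 0 < 1 - lam k * (1 - q j) := fun j => by
      nlinarith [mul_le_mul_of_nonneg_right (hlam k).2 (sub_nonneg.mpr (hq j).2.le), (hq j).1]
    obtain ⟨j, -, hj⟩ : ∃ j ∈ Finset.univ, 0 < p k j :=
      Finset.exists_lt_of_sum_lt (by simp [hrow])
    rw [hrw]
    exact Finset.sum_pos' (fun i _ => mul_nonneg (hp k i) (hw i).le)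
      ⟨j, Finset.mem_univ j, mul_pos hj (hw j)⟩
  exact ⟨Matrix.isUnit_of_offDiag_nonpos_of_sum_row_pos hoff hsum,
    Matrix.inv_nonneg_of_offDiag_nonpos_of_sum_row_pos hoff hsum⟩
end

section
/- Let U : ℝ → ℝ be continuously differentiable and strictly concave, with deriv U z > 0 for all z < 0, deriv U 0 = 0, and deriv U z < 0 for all z > 0. Let α̂ < E be real numbers and λ ∈ (0,1). If x is a real number satisfying the first-order condition (1 − λ) * deriv U (α̂ − x) + λ * deriv U (E − x) = 0, then α̂ < x < E. -/
/-- The subjective best response lies strictly between the perceived return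
and the peer statistic. -/
theorem stmt_14 (U : ℝ → ℝ)
    (hC1 : ContDiff ℝ 1 U)
    (hconc : StrictConcaveOn ℝ Set.univ U)
    (hpos : ∀ z < (0:ℝ), 0 < deriv U z)
    (h0 : deriv U 0 = 0)
    (hneg : ∀ z > (0:ℝ), deriv U z < 0)
    (αhat E : ℝ) (hE : αhat < E)
    (lam : ℝ) (hlam : lam ∈ Set.Ioo (0:ℝ) 1)
    (x : ℝ)
    (hfoc : (1 - lam) * deriv U (αhat - x) + lam * deriv U (E - x) = 0) :
    αhat < x ∧ x < E := by
  obtain ⟨hl0, hl1⟩ := hlam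
  have hl1' : 0 < 1 - lam := sub_pos.mpr hl1
  have nonpos : ∀ z, 0 ≤ z → deriv U z ≤ 0 := fun z hz =>
    hz.eq_or_lt.elim (fun h => h ▸ h0.le) (fun h => (hneg z h).le)
  have nonneg : ∀ z, z ≤ 0 → 0 ≤ deriv U z := fun z hz =>
    hz.eq_or_lt.elim (fun h => h ▸ h0.ge) (fun h => (hpos z h).le)
  constructor
  · by_contra! h
    have h1 := mul_nonpos_of_nonneg_of_nonpos hl1'.le (nonpos (αhat - x) (by linarith))
    have h2 := mul_neg_of_pos_of_neg hl0 (hneg (E - x) (by linarith))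
    linarith
  · by_contra! h
    have h1 := mul_pos hl1' (hpos (αhat - x) (by linarith))
    have h2 := mul_nonneg hl0.le (nonneg (E - x) (by linarith))
    linarith
end

section
/- Let U : ℝ → ℝ be continuously differentiable and strictly concave, with deriv U z > 0 for all z < 0, deriv U 0 = 0, and deriv U z < 0 for all z > 0. Let α̂ < E be real numbers, let λ', λ'' ∈ [0,1] with λ' < λ'', and suppose x' is a global maximizer over ℝ of x ↦ (1 − λ') * U (α̂ − x) + λ' * U (E − x) and x'' is a global maximizer over ℝ of x ↦ (1 − λ'') * U (α̂ − x) + λ'' * U (E − x). Then x' < x''. -/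
/-- First-order condition at a global maximizer of a weighted sum of two reflected translates. -/
theorem weighted_deriv_eq_zero_of_isMax {U : ℝ → ℝ} (hU : Differentiable ℝ U) {a b l x : ℝ}
    (hx : ∀ y : ℝ, (1 - l) * U (a - y) + l * U (b - y) ≤
      (1 - l) * U (a - x) + l * U (b - x)) :
    (1 - l) * deriv U (a - x) + l * deriv U (b - x) = 0 := by
  have hshift (c : ℝ) : HasDerivAt (fun y => U (c - y)) (-deriv U (c - x)) x :=
    (hU (c - x)).hasDerivAt.comp_const_sub c x
  have hmax : IsLocalMax (fun y => (1 - l) * U (a - y) + l * U (b - y)) x :=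
    Filter.Eventually.of_forall hx
  have hderiv := hmax.hasDerivAt_eq_zero
    (((hshift a).const_mul (1 - l)).add ((hshift b).const_mul l))
  linarith

/-- The subjective best response is strictly increasing in the conformity
weight when the peer statistic exceeds the perceived return. -/
theorem stmt_15 (U : ℝ → ℝ)
    (hC1 : ContDiff ℝ 1 U)
    (hconc : StrictConcaveOn ℝ Set.univ U)
    (hpos : ∀ z < (0:ℝ), 0 < deriv U z)
    (h0 : deriv U 0 = 0)
    (hneg : ∀ z > (0:ℝ), deriv U z < 0)
    (αhat E : ℝ) (hE : αhat < E)
    (lam' lam'' : ℝ)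
    (hlam' : lam' ∈ Set.Icc (0:ℝ) 1) (hlam'' : lam'' ∈ Set.Icc (0:ℝ) 1)
    (hlt : lam' < lam'')
    (x' x'' : ℝ)
    (hx' : ∀ y : ℝ, (1 - lam') * U (αhat - y) + lam' * U (E - y) ≤
      (1 - lam') * U (αhat - x') + lam' * U (E - x'))
    (hx'' : ∀ y : ℝ, (1 - lam'') * U (αhat - y) + lam'' * U (E - y) ≤
      (1 - lam'') * U (αhat - x'') + lam'' * U (E - x'')) :
    x' < x'' := by
  have hU : Differentiable ℝ U := hC1.differentiable one_ne_zero
  have hanti : StrictAnti (deriv U) :=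
    strictAntiOn_univ.1 (hconc.strictAntiOn_deriv fun x _ => hU x)
  have foc' := weighted_deriv_eq_zero_of_isMax hU hx'
  have foc'' := weighted_deriv_eq_zero_of_isMax hU hx''
  by_contra! hle
  have hα : deriv U (αhat - x'') ≤ deriv U (αhat - x') := hanti.antitone (by linarith)
  have hE' : deriv U (E - x'') ≤ deriv U (E - x') := hanti.antitone (by linarith)
  have hgap : deriv U (E - x') < deriv U (αhat - x') := hanti (by linarith)
  have hα_mul := mul_le_mul_of_nonneg_left hα (sub_nonneg.2 hlam''.2)
  have hE_mul := mul_le_mul_of_nonneg_left hE' hlam''.1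
  have hgap_mul := mul_pos (sub_pos.2 hlt) (sub_pos.2 hgap)
  linarith
end

section
/- Let U : ℝ → ℝ be continuously differentiable and strictly concave, with deriv U z > 0 for all z < 0, deriv U 0 = 0, and deriv U z < 0 for all z > 0. Let α̂, E be real numbers with α̂ ≠ E, and let x : [0,1] → ℝ be a function such that for each λ ∈ [0,1], x λ is a global maximizer over ℝ of z ↦ (1 − λ) * U (α̂ − z) + λ * U (E − z). Define τ : [0,1] → ℝ by τ λ = (x λ − α̂) / (E − α̂). Then τ 0 = 0, τ 1 = 1, τ λ ∈ [0,1] for every λ ∈ [0,1], and τ is strictly increasing; consequently, for every λ ∈ [0,1], x λ = (1 − τ λ) * α̂ + τ λ * E with τ λ ∈ [0,1] uniquely determined. -/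
/-- Endpoint values, range and monotone comparative statics of the zero of a strictly decreasing marginal
payoff, averaged with weights `1 - l` and `l` over the targets `0` and `1`. -/
theorem weighted_zero_unitInterval {g : ℝ → ℝ} (hg : StrictAnti g) (g0 : g 0 = 0) {t : ℝ → ℝ}
    (ht : ∀ l ∈ Set.Icc (0:ℝ) 1, (1 - l) * g (-t l) + l * g (1 - t l) = 0) :
    t 0 = 0 ∧ t 1 = 1 ∧ (∀ l ∈ Set.Icc (0:ℝ) 1, t l ∈ Set.Icc (0:ℝ) 1) ∧
      StrictMonoOn t (Set.Icc (0:ℝ) 1) := by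
  refine ⟨?_, ?_, fun l hl => ⟨?_, ?_⟩, fun a ha b hb hab => ?_⟩
  · have h : g (-t 0) = g 0 := by simpa [g0] using ht 0 (by simp)
    linarith [hg.injective h]
  · have h : g (1 - t 1) = g 0 := by simpa [g0] using ht 1 (by simp)
    linarith [hg.injective h]
  · by_contra! h
    have h1 : g (-t l) < g 0 := hg (by linarith)
    have h2 : g (1 - t l) < g (-t l) := hg (by linarith)
    nlinarith [ht l hl, hl.1, hl.2]
  · by_contra! h
    have h1 : g 0 < g (1 - t l) := hg (by linarith)
    have h2 : g (1 - t l) < g (-t l) := hg (by linarith)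
    nlinarith [ht l hl, hl.1, hl.2]
  · by_contra! h
    have h1 : g (-t b) ≤ g (-t a) := hg.antitone (by linarith)
    have h2 : g (1 - t b) ≤ g (1 - t a) := hg.antitone (by linarith)
    have h3 : g (1 - t a) < g (-t a) := hg (by linarith)
    have h4 := mul_le_mul_of_nonneg_left h1 (sub_nonneg.2 hb.2)
    have h5 := mul_le_mul_of_nonneg_left h2 hb.1
    nlinarith [ht a ha, ht b hb, mul_pos (sub_pos.2 hab) (sub_pos.2 h3)]

/-- Linear representation of the subjective best response in a transformed
conformity parameter. -/
theorem stmt_16 (U : ℝ → ℝ)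
    (hC1 : ContDiff ℝ 1 U)
    (hconc : StrictConcaveOn ℝ Set.univ U)
    (hpos : ∀ z < (0:ℝ), 0 < deriv U z)
    (h0 : deriv U 0 = 0)
    (hneg : ∀ z > (0:ℝ), deriv U z < 0)
    (αhat E : ℝ) (hE : αhat ≠ E)
    (x : ℝ → ℝ)
    (hx : ∀ lam ∈ Set.Icc (0:ℝ) 1, ∀ z : ℝ,
      (1 - lam) * U (αhat - z) + lam * U (E - z) ≤
      (1 - lam) * U (αhat - x lam) + lam * U (E - x lam))
    (τ : ℝ → ℝ)
    (hτ : ∀ lam, τ lam = (x lam - αhat) / (E - αhat)) :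
    τ 0 = 0 ∧ τ 1 = 1 ∧ (∀ lam ∈ Set.Icc (0:ℝ) 1, τ lam ∈ Set.Icc (0:ℝ) 1) ∧
    StrictMonoOn τ (Set.Icc (0:ℝ) 1) ∧
    ∀ lam ∈ Set.Icc (0:ℝ) 1,
      x lam = (1 - τ lam) * αhat + τ lam * E ∧
      ∃! t : ℝ, t ∈ Set.Icc (0:ℝ) 1 ∧ x lam = (1 - t) * αhat + t * E := by
  have hd : E - αhat ≠ 0 := sub_ne_zero.2 hE.symm
  have hU : Differentiable ℝ U := hC1.differentiable (by norm_num)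
  have hanti : StrictAnti (deriv U) := by
    have := hconc.strictAntiOn_deriv fun z _ => hU z
    exact strictAntiOn_univ.1 this
  have foc : ∀ l ∈ Set.Icc (0:ℝ) 1,
      (1 - l) * deriv U (αhat - x l) + l * deriv U (E - x l) = 0 := by
    intro l hl
    have hder (c : ℝ) : HasDerivAt (fun z => U (c - z)) (-deriv U (c - x l)) (x l) :=
      (hU (c - x l)).hasDerivAt.comp_const_sub c (x l)
    have hmax : IsLocalMax (fun z => (1 - l) * U (αhat - z) + l * U (E - z)) (x l) :=
      Filter.Eventually.of_forall (hx l hl)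
    have := hmax.hasDerivAt_eq_zero (((hder αhat).const_mul (1 - l)).add ((hder E).const_mul l))
    linarith
  have hxτ (l : ℝ) : x l = αhat + τ l * (E - αhat) := by
    rw [hτ]; field_simp; ring
  have hg : StrictAnti fun s => (E - αhat) * deriv U ((E - αhat) * s) := by
    intro s t hst
    rcases hd.lt_or_gt with h | h
    · exact mul_lt_mul_of_neg_left (hanti (mul_lt_mul_of_neg_left hst h)) h
    · exact mul_lt_mul_of_pos_left (hanti (mul_lt_mul_of_pos_left hst h)) h
  obtain ⟨hτ0, hτ1, hmem, hmono⟩ := weighted_zero_unitInterval hg (by simp [h0]) (t := τ) (by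
    intro l hl
    have h1 : (E - αhat) * -τ l = αhat - x l := by rw [hxτ]; ring
    have h2 : (E - αhat) * (1 - τ l) = E - x l := by rw [hxτ]; ring
    simp only [h1, h2]
    linear_combination (E - αhat) * foc l hl)
  refine ⟨hτ0, hτ1, hmem, hmono, fun l hl => ?_⟩
  have hrep : x l = (1 - τ l) * αhat + τ l * E := by rw [hxτ]; ring
  refine ⟨hrep, τ l, ⟨hmem l hl, hrep⟩, fun t ht => mul_right_cancel₀ hd ?_⟩
  linear_combination hrep - ht.2
end
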